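/- arXiv:1907.07856 — 2 statements merged into one kernel-verified Lean document; each statement's English description precedes it below -/
import Mathlib

section
/- Let r ∈ ℕ, let k = (k_1,…,k_r), l = (l_1,…,l_r), m = (m_1,…,m_r) ∈ ℕ_0^r, and let f, g ∈ ℓ²(F_∞^r) be supported in E_k and E_l respectively. If for every 1 ≤ j ≤ r one has |k_j − l_j| ≤ m_j ≤ k_j + l_j and k_j + l_j − m_j is even, then ‖(f*g)·χ_{E_m}‖_{ℓ²(F_∞^r)} ≤ ‖f‖_{ℓ²(F_∞^r)} · ‖g‖_{ℓ²(F_∞^r)}. -/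
open scoped ENNReal

noncomputable section

/-- The free group on countably many generators `g_0, g_1, g_2, …`. -/
abbrev FG : Type := FreeGroup ℕ

/-- The reduced word length of an element of the free group. -/
def wordLength (x : FG) : ℕ := (FreeGroup.toWord x).length

/-- `ℓ²(F_∞^r)`. -/
abbrev l2 (r : ℕ) : Type := lp (fun _ : Fin r → FG => ℂ) 2

/-- Convolution of two elements of `ℓ²(F_∞^r)`:
`(f*g)(s) = Σ_{t u = s} f(t) g(u)`. -/
def conv {r : ℕ} (f g : l2 r) (s : Fin r → FG) : ℂ :=
  ∑' t : Fin r → FG, f t * g (t⁻¹ * s)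

namespace FreeGroup

variable {α : Type*} [DecidableEq α]

theorem toWord_mul_of_norm_mul {x y : FreeGroup α} (h : norm (x * y) = norm x + norm y) :
    toWord (x * y) = toWord x ++ toWord y :=
  (toWord_mul_sublist x y).eq_of_length (by simpa [norm] using h)

/-- The left factor of a cancellation-free product is determined by its length. -/
theorem eq_of_mul_eq_mul_of_norm {x y x' y' : FreeGroup α}
    (h : norm (x * y) = norm x + norm y) (h' : norm (x' * y') = norm x' + norm y')
    (heq : x * y = x' * y') (hx : norm x = norm x') : x = x' := by
  have e : toWord x ++ toWord y = toWord x' ++ toWord y' := by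
    rw [← toWord_mul_of_norm_mul h, ← toWord_mul_of_norm_mul h', heq]
  exact toWord_injective (List.append_inj e hx).1

/-- If a product involves cancellation, the last letter of the left factor is inverse to the
first letter of the right factor. -/
theorem exists_cancel_of_norm_mul_ne {t u : FreeGroup α} (h : norm (t * u) ≠ norm t + norm u) :
    ∃ t' x u', t = t' * x ∧ u = x⁻¹ * u' ∧ norm x = 1 ∧ norm t = norm t' + 1 ∧
      norm u = norm u' + 1 := by
  have hred : ¬ IsReduced (toWord t ++ toWord u) := fun hr => h (by
    simp [norm, toWord_mul, hr.reduce_eq])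
  have hj : ∃ a ∈ (toWord t).getLast?, ∃ b ∈ (toWord u).head?, ¬ (a.1 = b.1 → a.2 = b.2) := by
    by_contra! hc
    exact hred (List.isChain_append.2 ⟨isReduced_toWord, isReduced_toWord,
      fun a ha b hb => hc a ha b hb⟩)
  obtain ⟨⟨i, ε⟩, ha, ⟨i', δ⟩, hb, hab⟩ := hj
  simp only [Classical.not_imp] at hab
  obtain ⟨rfl, hne⟩ := hab
  have hδ : δ = !ε := by cases ε <;> cases δ <;> simp_all
  subst hδ
  obtain ⟨L, hL⟩ := List.getLast?_eq_some_iff.1 ha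
  obtain ⟨R, hR⟩ := List.head?_eq_some_iff.1 hb
  have hLr : IsReduced L := (isReduced_toWord (x := t)).infix ⟨[], [(i, ε)], by simp [hL]⟩
  have hRr : IsReduced R := (isReduced_toWord (x := u)).infix ⟨[(i, !ε)], [], by simp [hR]⟩
  refine ⟨mk L, mk [(i, ε)], mk R, ?_, ?_, ?_, ?_, ?_⟩
  · rw [mul_mk, ← hL, mk_toWord]
  · rw [inv_mk, mul_mk]
    simp [invRev, ← hR, mk_toWord]
  · simp [norm]
  · simp [norm, hL, hLr.reduce_eq]
  · simp [norm, hR, hRr.reduce_eq]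

/-- If `2 * q` letters cancel in the product `t * u`, then `t = a * c` and `u = c⁻¹ * b` without
cancellation, where `c` has length `q`. -/
theorem exists_norm_eq_of_norm_mul {t u : FreeGroup α} {q : ℕ}
    (h : norm (t * u) + 2 * q = norm t + norm u) :
    ∃ c, norm c = q ∧ norm (t * c⁻¹) + q = norm t ∧ norm (c * u) + q = norm u := by
  induction q generalizing t u with
  | zero => exact ⟨1, by simp⟩
  | succ q ih =>
    obtain ⟨t', x, u', rfl, rfl, hx, ht, hu⟩ :=
      exists_cancel_of_norm_mul_ne (t := t) (u := u) (by omega)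
    have e : t' * x * (x⁻¹ * u') = t' * u' := by group
    rw [e] at h
    obtain ⟨c, hc, hct, hcu⟩ := ih (t := t') (u := u') (by omega)
    have e₁ : t' * x * (c * x)⁻¹ = t' * c⁻¹ := by group
    have e₂ : c * x * (x⁻¹ * u') = c * u' := by group
    refine ⟨c * x, le_antisymm ?_ ?_, ?_, ?_⟩
    · exact (norm_mul_le c x).trans (by omega)
    · have := norm_mul_le (t' * c⁻¹) (c * x)
      rw [show t' * c⁻¹ * (c * x) = t' * x by group] at this
      omega
    · rw [e₁]; omega
    · rw [e₂]; omega

end FreeGroup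

namespace ENNReal

theorem sq_tsum_mul_le {ι : Type*} (f g : ι → ℝ≥0∞) :
    (∑' i, f i * g i) ^ 2 ≤ (∑' i, f i ^ 2) * ∑' i, g i ^ 2 := by
  have key : ∑' i, f i * g i ≤
      (∑' i, f i ^ 2) ^ (1 / 2 : ℝ) * (∑' i, g i ^ 2) ^ (1 / 2 : ℝ) := by
    rw [ENNReal.tsum_eq_iSup_sum]
    refine iSup_le fun s => ?_
    refine (ENNReal.inner_le_Lp_mul_Lq s f g Real.HolderConjugate.two_two).trans ?_
    simp only [ENNReal.rpow_two]
    gcongr <;> exact ENNReal.sum_le_tsum s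
  calc (∑' i, f i * g i) ^ 2
      ≤ ((∑' i, f i ^ 2) ^ (1 / 2 : ℝ) * (∑' i, g i ^ 2) ^ (1 / 2 : ℝ)) ^ 2 := by gcongr
    _ = _ := by
      rw [mul_pow, ← ENNReal.rpow_two, ← ENNReal.rpow_two, ← ENNReal.rpow_mul,
        ← ENNReal.rpow_mul]
      norm_num

theorem tsum_indicator_comp_le {ι κ : Type*} {S : Set ι} {π : ι → κ} (hπ : S.InjOn π)
    (f : κ → ℝ≥0∞) : ∑' i, S.indicator (f ∘ π) i ≤ ∑' j, f j := by
  rw [← tsum_subtype]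
  exact ENNReal.tsum_comp_le_tsum_of_injective hπ.injective f

end ENNReal

open Classical in
/-- An abstract Haagerup-type inequality: convolution on a group, restricted to a set `M` on which
products from `K × L` factor uniquely through `A`, `B` and a set `Q` of cancelling parts. -/
theorem tsum_indicator_sq_conv_le {G : Type*} [Group G] {K L M A B Q : Set G}
    (hdec : ∀ t ∈ K, ∀ u ∈ L, t * u ∈ M → ∃ c ∈ Q, t * c⁻¹ ∈ A ∧ c * u ∈ B)
    (hM : ∀ a ∈ A, ∀ a' ∈ A, ∀ b ∈ B, ∀ b' ∈ B, a * b ∈ M → a * b = a' * b' → a = a')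
    (hK : ∀ a ∈ A, ∀ a' ∈ A, ∀ c ∈ Q, ∀ c' ∈ Q, a * c ∈ K → a * c = a' * c' → a = a')
    (hL : ∀ c ∈ Q, ∀ c' ∈ Q, ∀ b ∈ B, ∀ b' ∈ B, c⁻¹ * b ∈ L → c⁻¹ * b = c'⁻¹ * b' → c = c')
    {f g : G → ℝ≥0∞} (hf : ∀ t, f t ≠ 0 → t ∈ K) (hg : ∀ t, g t ≠ 0 → t ∈ L) :
    ∑' s, M.indicator (fun s => (∑' t, f t * g (t⁻¹ * s)) ^ 2) s ≤
      (∑' t, f t ^ 2) * ∑' t, g t ^ 2 := by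
  set φ : G → G → ℝ≥0∞ := fun a c => if a ∈ A ∧ c ∈ Q then f (a * c) else 0 with hφ
  set ψ : G → G → ℝ≥0∞ := fun b c => if b ∈ B ∧ c ∈ Q then g (c⁻¹ * b) else 0 with hψ
  have hF : ∑' a, ∑' c, φ a c ^ 2 ≤ ∑' t, f t ^ 2 := by
    rw [← ENNReal.tsum_prod (f := fun a c => φ a c ^ 2)]
    refine le_trans (le_of_eq (tsum_congr ?_)) (ENNReal.tsum_indicator_comp_le
      (S := {p : G × G | p.1 ∈ A ∧ p.2 ∈ Q ∧ p.1 * p.2 ∈ K}) (π := fun p => p.1 * p.2) ?_ _)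
    · rintro ⟨a, c⟩
      by_cases h : f (a * c) = 0
      · simp [hφ, h, Set.indicator]
      · simp [hφ, Set.indicator, hf _ h, ite_pow]
    · rintro ⟨a, c⟩ ⟨ha, hc, hac⟩ ⟨a', c'⟩ ⟨ha', hc', -⟩ (e : a * c = a' * c')
      obtain rfl := hK a ha a' ha' c hc c' hc' hac e
      rw [mul_left_cancel e]
  have hG : ∑' b, ∑' c, ψ b c ^ 2 ≤ ∑' t, g t ^ 2 := by
    rw [← ENNReal.tsum_prod (f := fun b c => ψ b c ^ 2)]
    refine le_trans (le_of_eq (tsum_congr ?_)) (ENNReal.tsum_indicator_comp_le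
      (S := {p : G × G | p.1 ∈ B ∧ p.2 ∈ Q ∧ p.2⁻¹ * p.1 ∈ L}) (π := fun p => p.2⁻¹ * p.1) ?_ _)
    · rintro ⟨b, c⟩
      by_cases h : g (c⁻¹ * b) = 0
      · simp [hψ, h, Set.indicator]
      · simp [hψ, Set.indicator, hg _ h, ite_pow]
    · rintro ⟨b, c⟩ ⟨hb, hc, hbc⟩ ⟨b', c'⟩ ⟨hb', hc', -⟩ (e : c⁻¹ * b = c'⁻¹ * b')
      obtain rfl := hL c hc c' hc' b hb b' hb' hbc e
      rw [mul_left_cancel e]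
  have hpt : ∀ s, M.indicator (fun s => (∑' t, f t * g (t⁻¹ * s)) ^ 2) s ≤
      ∑' a, (∑' c, φ a c ^ 2) * ∑' c, ψ (a⁻¹ * s) c ^ 2 := by
    intro s
    by_cases hs : s ∈ M
    swap
    · simp [hs]
    rw [Set.indicator_of_mem hs]
    have hfac : ∀ t, f t * g (t⁻¹ * s) ≠ 0 →
        ∃ c ∈ Q, t * c⁻¹ ∈ A ∧ (t * c⁻¹)⁻¹ * s ∈ B := by
      intro t ht
      obtain ⟨c, hc, h₁, h₂⟩ := hdec t (hf _ (left_ne_zero_of_mul ht)) (t⁻¹ * s)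
        (hg _ (right_ne_zero_of_mul ht)) (by simpa using hs)
      exact ⟨c, hc, h₁, by simpa [mul_assoc] using h₂⟩
    by_cases hz : ∀ t, f t * g (t⁻¹ * s) = 0
    · simp [hz]
    push Not at hz
    obtain ⟨t₀, ht₀⟩ := hz
    obtain ⟨c₀, -, ha, hb⟩ := hfac t₀ ht₀
    set a := t₀ * c₀⁻¹
    refine le_trans ?_ (ENNReal.le_tsum a)
    refine le_trans (le_of_eq ?_) (ENNReal.sq_tsum_mul_le _ _)
    congr 1
    rw [← (Equiv.mulLeft a).tsum_eq]
    refine tsum_congr fun c => ?_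
    have e : (a * c)⁻¹ * s = c⁻¹ * (a⁻¹ * s) := by group
    by_cases hc : c ∈ Q
    · simp only [hφ, hψ, ha, hb, hc, and_self, if_true, Equiv.coe_mulLeft, e]
    · simp only [hφ, hψ, hc, and_false, if_false, mul_zero, Equiv.coe_mulLeft]
      by_contra hne
      obtain ⟨c', hc', ha', hb'⟩ := hfac _ hne
      have haa := hM a ha _ ha' _ hb _ hb' (by simpa using hs) (by simp only [mul_inv_cancel_left])
      have : c = c' := by
        rw [mul_assoc, eq_comm, mul_eq_left, mul_inv_eq_one] at haa
        exact haa
      exact hc (this ▸ hc')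
  calc _ ≤ ∑' s, ∑' a, (∑' c, φ a c ^ 2) * ∑' c, ψ (a⁻¹ * s) c ^ 2 := ENNReal.tsum_le_tsum hpt
    _ = ∑' a, ∑' s, (∑' c, φ a c ^ 2) * ∑' c, ψ (a⁻¹ * s) c ^ 2 := ENNReal.tsum_comm
    _ = ∑' a, (∑' c, φ a c ^ 2) * ∑' b, ∑' c, ψ b c ^ 2 := by
      refine tsum_congr fun a => ?_
      rw [ENNReal.tsum_mul_left]
      congr 1
      exact (Equiv.mulLeft a⁻¹).tsum_eq (fun b => ∑' c, ψ b c ^ 2)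
    _ = (∑' a, ∑' c, φ a c ^ 2) * ∑' b, ∑' c, ψ b c ^ 2 := ENNReal.tsum_mul_right
    _ ≤ _ := by gcongr

theorem tsum_enorm_sq_eq {r : ℕ} (f : l2 r) : ∑' t, ‖f t‖ₑ ^ 2 = ‖f‖ₑ ^ 2 := by
  have h := lp.hasSum_norm (p := 2) (by norm_num) f
  simp only [ENNReal.toReal_ofNat, Real.rpow_two] at h
  rw [← ofReal_norm, ← ENNReal.ofReal_pow (norm_nonneg _), ← h.tsum_eq,
    ENNReal.ofReal_tsum_of_nonneg (fun _ => by positivity) h.summable]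
  simp_rw [ENNReal.ofReal_pow (norm_nonneg _), ofReal_norm]

/-- A function whose squares sum to at most `C ^ 2` is an element of `ℓ²` of norm at most `C`. -/
theorem exists_l2_of_tsum_enorm_sq_le {r : ℕ} {F : (Fin r → FG) → ℂ} {C : ℝ} (hC : 0 ≤ C)
    (h : ∑' t, ‖F t‖ₑ ^ 2 ≤ ENNReal.ofReal C ^ 2) :
    ∃ f : l2 r, (∀ t, f t = F t) ∧ ‖f‖ ≤ C := by
  have hF : Memℓp F 2 := by
    refine memℓp_gen ?_
    simp only [ENNReal.toReal_ofNat, Real.rpow_two]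
    have hs := ENNReal.summable_toReal
      (ne_top_of_le_ne_top (ENNReal.pow_ne_top ENNReal.ofReal_ne_top) h)
    simpa using hs
  refine ⟨⟨F, hF⟩, fun _ => rfl, ?_⟩
  have h' := tsum_enorm_sq_eq (⟨F, hF⟩ : l2 r)
  change ∑' t, ‖F t‖ₑ ^ 2 = _ at h'
  rw [h', ENNReal.pow_le_pow_left_iff two_ne_zero, ← ofReal_norm,
    ENNReal.ofReal_le_ofReal_iff hC] at h
  exact h

/-- If `f` is supported in `E_k`, `g` is supported in `E_l`, and for every `j` one has
`|k_j − l_j| ≤ m_j ≤ k_j + l_j` with `k_j + l_j − m_j` even, then the truncation of `f*g`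
to `E_m` is square-summable with `‖(f*g)·χ_{E_m}‖₂ ≤ ‖f‖₂ ‖g‖₂`. -/
theorem conv_truncation_le (r : ℕ) (k l m : Fin r → ℕ)
    (f g : l2 r)
    (hf : ∀ t : Fin r → FG, f t ≠ 0 → ∀ j, wordLength (t j) = k j)
    (hg : ∀ t : Fin r → FG, g t ≠ 0 → ∀ j, wordLength (t j) = l j)
    (hm : ∀ j, ((k j : ℤ) - (l j : ℤ)).natAbs ≤ m j ∧ m j ≤ k j + l j ∧
      Even (k j + l j - m j)) :
    ∃ h : l2 r,
      (∀ s : Fin r → FG,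
        h s = if ∀ j, wordLength (s j) = m j then conv f g s else 0) ∧
      ‖h‖ ≤ ‖f‖ * ‖g‖ := by
  set S : (Fin r → ℕ) → Set (Fin r → FG) := fun p => {x | ∀ j, FreeGroup.norm (x j) = p j}
  obtain ⟨q, hq⟩ : ∃ q : Fin r → ℕ, ∀ j, m j + 2 * q j = k j + l j := by
    refine ⟨fun j => (k j + l j - m j) / 2, fun j => ?_⟩
    obtain ⟨-, h, n, hn⟩ := hm j
    change m j + 2 * ((k j + l j - m j) / 2) = _
    omega
  have hqk : ∀ j, q j ≤ k j ∧ q j ≤ l j := fun j => by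
    have := hq j
    have := (hm j).1
    omega
  have key := tsum_indicator_sq_conv_le (K := S k) (L := S l) (M := S m) (A := S (k - q))
    (B := S (l - q)) (Q := S q) (f := fun t => ‖f t‖ₑ) (g := fun t => ‖g t‖ₑ)
    (by
      intro t ht u hu htu
      have : ∀ j, ∃ c, FreeGroup.norm c = q j ∧ FreeGroup.norm (t j * c⁻¹) + q j =
          FreeGroup.norm (t j) ∧ FreeGroup.norm (c * u j) + q j = FreeGroup.norm (u j) := by
        intro j
        apply FreeGroup.exists_norm_eq_of_norm_mul
        have h : FreeGroup.norm (t j * u j) = m j := htu j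
        rw [ht j, hu j, h, hq j]
      choose c hc hct hcu using this
      refine ⟨c, hc, fun j => ?_, fun j => ?_⟩
      · have := hct j
        have := ht j
        simp only [Pi.mul_apply, Pi.inv_apply, Pi.sub_apply]
        omega
      · have := hcu j
        have := hu j
        simp only [Pi.mul_apply, Pi.sub_apply]
        omega)
    (by
      intro a ha a' ha' b hb b' hb' hab e
      funext j
      have h₁ := ha j
      have h₂ := ha' j
      have h₃ := hb j
      have h₄ := hb' j
      have h₅ := hab j
      have h₆ := congrFun e j
      have := hq j
      have := hqk j
      simp only [Pi.mul_apply, Pi.sub_apply] at h₁ h₂ h₃ h₄ h₅ h₆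
      exact FreeGroup.eq_of_mul_eq_mul_of_norm (by omega) (by rw [← h₆]; omega) h₆ (by omega))
    (by
      intro a ha a' ha' c hc c' hc' hac e
      funext j
      have h₁ := ha j
      have h₂ := ha' j
      have h₃ := hc j
      have h₄ := hc' j
      have h₅ := hac j
      have h₆ := congrFun e j
      have := hqk j
      simp only [Pi.mul_apply, Pi.sub_apply] at h₁ h₂ h₃ h₄ h₅ h₆
      exact FreeGroup.eq_of_mul_eq_mul_of_norm (by omega) (by rw [← h₆]; omega) h₆ (by omega))
    (by
      intro c hc c' hc' b hb b' hb' hcb e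
      funext j
      have h₁ := hc j
      have h₂ := hc' j
      have h₃ := hb j
      have h₄ := hb' j
      have h₅ := hcb j
      have h₆ := congrFun e j
      have := hqk j
      simp only [Pi.mul_apply, Pi.inv_apply, Pi.sub_apply] at h₁ h₂ h₃ h₄ h₅ h₆
      rw [← FreeGroup.norm_inv_eq] at h₁ h₂
      exact inv_injective
        (FreeGroup.eq_of_mul_eq_mul_of_norm (by omega) (by rw [← h₆]; omega) h₆ (by omega)))
    (fun t ht => hf t (by simpa using ht)) (fun t ht => hg t (by simpa using ht))
  apply exists_l2_of_tsum_enorm_sq_le (by positivity)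
  rw [ENNReal.ofReal_mul (norm_nonneg _), ofReal_norm, ofReal_norm, mul_pow,
    ← tsum_enorm_sq_eq f, ← tsum_enorm_sq_eq g]
  refine le_trans (ENNReal.tsum_le_tsum fun s => ?_) key
  by_cases hs : ∀ j, wordLength (s j) = m j
  · rw [if_pos hs, Set.indicator_of_mem (show s ∈ S m from hs)]
    gcongr
    refine enorm_tsum_le_tsum_enorm.trans_eq (tsum_congr fun t => ?_)
    rw [enorm_mul]
  · simp [hs]
end
end

section
/- Let N ∈ ℕ with N ≥ 2 and let e denote the identity element of F_∞. Define the N² × N² matrix Ĝ indexed by pairs (i,j), (i',j') ∈ {1,…,N}² with entries Ĝ_{(i,j),(i',j')} = N^{-2}⟨U_{i'}V_{j'}δ_e, U_i V_j δ_e⟩. Then the von Neumann entropy of Ĝ satisfies H(Ĝ) = 2·log N − (log N)/N. Consequently, the minimum output entropy of the composed channel Φ_{N,l} ∘ Φ_{N,r} is at most 2·log N − (log N)/N. -/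
open scoped ENNReal

noncomputable section

/-- The generators `g_i` of the free group. -/
def gen (i : ℕ) : FG := FreeGroup.of i

/-- `ℓ²(F_∞)`. -/
abbrev l2FG : Type := lp (fun _ : FG => ℂ) 2

/-- The von Neumann entropy of a (Hermitian) matrix: `H(M) = −Σ_i λ_i log λ_i`, where
the `λ_i` are the eigenvalues of `M` (junk value `0` for non-Hermitian matrices). -/
def vnEntropy {n : Type*} [Fintype n] [DecidableEq n] (M : Matrix n n ℂ) : ℝ :=
  if h : M.IsHermitian then ∑ i, Real.negMulLog (h.eigenvalues i) else 0

/-- The output of the complementary channel of the composed channel `Φ_{N,l} ∘ Φ_{N,r}`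
at the pure state `|ξ⟩⟨ξ|`: the `N² × N²` matrix with entries
`Ĝ(ξ)_{(i,j),(i',j')} = N⁻²⟨U_{i'}V_{j'}ξ, U_iV_jξ⟩`, where
`(U_iV_jξ)(x) = ξ(g_i⁻¹ x g_j)`. -/
def Ghat (N : ℕ) (ξ : l2FG) : Matrix (Fin N × Fin N) (Fin N × Fin N) ℂ :=
  Matrix.of fun p q => ((N : ℂ) ^ 2)⁻¹ *
    ∑' x : FG,
      (starRingEnd ℂ) (ξ ((gen (q.1 : ℕ))⁻¹ * x * gen (q.2 : ℕ))) *
        ξ ((gen (p.1 : ℕ))⁻¹ * x * gen (p.2 : ℕ))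

/-- `δ_e ∈ ℓ²(F_∞)`, the standard basis vector at the identity element. -/
def deltaE : l2FG := lp.single 2 (1 : FG) (1 : ℂ)

lemma gen_mul_gen_inv_eq_iff (i j k l : ℕ) :
    gen i * (gen j)⁻¹ = gen k * (gen l)⁻¹ ↔ (i = k ∧ j = l) ∨ (i = j ∧ k = l) := by
  constructor
  · intro h
    let φ : FG →* Multiplicative (ℕ → ℤ) :=
      FreeGroup.lift fun m => Multiplicative.ofAdd (Pi.single m 1)
    have hφ : (Pi.single i 1 - Pi.single j 1 : ℕ → ℤ) = Pi.single k 1 - Pi.single l 1 := by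
      have := congrArg (fun x => Multiplicative.toAdd (φ x)) h
      simpa [φ, gen, sub_eq_add_neg] using this
    have hi := congrFun hφ i
    have hj := congrFun hφ j
    have hk := congrFun hφ k
    simp only [Pi.sub_apply, Pi.single_apply] at hi hj hk
    grind
  · rintro (⟨rfl, rfl⟩ | ⟨rfl, rfl⟩) <;> simp

lemma Ghat_deltaE_apply (N : ℕ) (p q : Fin N × Fin N) :
    Ghat N deltaE p q =
      ((N : ℂ) ^ 2)⁻¹ * if p = q ∨ (p.1 = p.2 ∧ q.1 = q.2) then 1 else 0 := by
  have hδ (i j : ℕ) (x : FG) : (deltaE : FG → ℂ) ((gen i)⁻¹ * x * gen j) =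
      if x = gen i * (gen j)⁻¹ then 1 else 0 := by
    have hx : (gen i)⁻¹ * x * gen j = 1 ↔ x = gen i * (gen j)⁻¹ := by
      rw [mul_eq_one_iff_eq_inv, inv_mul_eq_iff_eq_mul]
    simp [deltaE, lp.single_apply, Pi.single_apply, hx]
  have hpq : gen p.1 * (gen p.2)⁻¹ = gen q.1 * (gen q.2)⁻¹ ↔
      p = q ∨ (p.1 = p.2 ∧ q.1 = q.2) := by
    rw [gen_mul_gen_inv_eq_iff]
    simp [Prod.ext_iff, Fin.ext_iff]
  simp only [Ghat, Matrix.of_apply, hδ]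
  rw [tsum_eq_single (gen p.1 * (gen p.2)⁻¹) (by intro x hx; simp [hx])]
  simp [hpq]

/-- The indicator vector of the diagonal of `Fin N × Fin N`. -/
def diagIndicator (N : ℕ) : Fin N × Fin N → ℂ := fun p => if p.1 = p.2 then 1 else 0

lemma diagIndicator_dotProduct_self (N : ℕ) :
    diagIndicator N ⬝ᵥ diagIndicator N = N := by
  simp [diagIndicator, dotProduct, Fintype.sum_prod_type]

lemma Ghat_deltaE_eq (N : ℕ) :
    Ghat N deltaE = ((N : ℂ) ^ 2)⁻¹ • (Matrix.diagonal (1 - diagIndicator N) +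
      Matrix.vecMulVec (diagIndicator N) (diagIndicator N)) := by
  ext p q
  rw [Ghat_deltaE_apply]
  simp only [Matrix.smul_apply, Matrix.add_apply, Matrix.diagonal_apply, Matrix.vecMulVec_apply,
    diagIndicator, smul_eq_mul, Pi.sub_apply, Pi.one_apply]
  congr 1
  by_cases hpq : p = q
  · subst hpq
    by_cases h : p.1 = p.2 <;> simp [h]
  · by_cases h : p.1 = p.2 <;> simp [hpq, h]

lemma Ghat_deltaE_isHermitian (N : ℕ) : (Ghat N deltaE).IsHermitian := by
  ext p q
  have hqp : (q = p ∨ q.1 = q.2 ∧ p.1 = p.2) ↔ (p = q ∨ p.1 = p.2 ∧ q.1 = q.2) := by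
    rw [eq_comm, and_comm]
  simp only [Matrix.conjTranspose_apply, Ghat_deltaE_apply, star_mul', hqp]
  split_ifs <;> simp

lemma diagonal_one_sub_diagIndicator_mul_self (N : ℕ) :
    Matrix.diagonal (1 - diagIndicator N) * Matrix.diagonal (1 - diagIndicator N) =
      Matrix.diagonal (1 - diagIndicator N) := by
  rw [Matrix.diagonal_mul_diagonal]
  congr 1
  ext p
  by_cases h : p.1 = p.2 <;> simp [diagIndicator, h]

lemma diagonal_mul_vecMulVec_diagIndicator (N : ℕ) :
    Matrix.diagonal (1 - diagIndicator N) *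
      Matrix.vecMulVec (diagIndicator N) (diagIndicator N) = 0 := by
  ext p q
  by_cases h : p.1 = p.2 <;>
    simp [Matrix.diagonal_mul, Matrix.vecMulVec_apply, diagIndicator, h]

lemma vecMulVec_diagIndicator_mul_diagonal (N : ℕ) :
    Matrix.vecMulVec (diagIndicator N) (diagIndicator N) *
      Matrix.diagonal (1 - diagIndicator N) = 0 := by
  ext p q
  by_cases h : q.1 = q.2 <;>
    simp [Matrix.mul_diagonal, Matrix.vecMulVec_apply, diagIndicator, h]

lemma vecMulVec_diagIndicator_mul_self (N : ℕ) :
    Matrix.vecMulVec (diagIndicator N) (diagIndicator N) *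
      Matrix.vecMulVec (diagIndicator N) (diagIndicator N) =
      (N : ℂ) • Matrix.vecMulVec (diagIndicator N) (diagIndicator N) := by
  rw [Matrix.vecMulVec_mul_vecMulVec, diagIndicator_dotProduct_self]
  ext p q
  simp [Matrix.vecMulVec_apply, mul_left_comm]

lemma Ghat_deltaE_mul_self (N : ℕ) :
    Ghat N deltaE * Ghat N deltaE = (((N : ℂ) ^ 2)⁻¹) ^ 2 •
      (Matrix.diagonal (1 - diagIndicator N) +
        (N : ℂ) • Matrix.vecMulVec (diagIndicator N) (diagIndicator N)) := by
  rw [Ghat_deltaE_eq, Matrix.smul_mul, Matrix.mul_smul, smul_smul, ← sq]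
  simp only [mul_add, add_mul, diagonal_one_sub_diagIndicator_mul_self,
    diagonal_mul_vecMulVec_diagIndicator, vecMulVec_diagIndicator_mul_diagonal,
    vecMulVec_diagIndicator_mul_self, add_zero, zero_add]

lemma Ghat_deltaE_cube (N : ℕ) (hN : N ≠ 0) :
    Ghat N deltaE * (Ghat N deltaE * Ghat N deltaE) =
      (((N : ℂ) ^ 2)⁻¹ + (N : ℂ)⁻¹) • (Ghat N deltaE * Ghat N deltaE) -
        ((N : ℂ) ^ 3)⁻¹ • Ghat N deltaE := by
  have hc : (N : ℂ) ≠ 0 := by exact_mod_cast hN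
  rw [Ghat_deltaE_mul_self, Ghat_deltaE_eq, Matrix.smul_mul, Matrix.mul_smul]
  simp only [mul_add, add_mul, Matrix.mul_smul, diagonal_one_sub_diagIndicator_mul_self,
    diagonal_mul_vecMulVec_diagIndicator, vecMulVec_diagIndicator_mul_diagonal,
    vecMulVec_diagIndicator_mul_self, add_zero, zero_add, smul_zero]
  match_scalars <;> field_simp <;> ring

lemma trace_diagonal_one_sub_diagIndicator (N : ℕ) :
    (Matrix.diagonal (1 - diagIndicator N)).trace = (N : ℂ) ^ 2 - N := by
  have h : ∑ p, diagIndicator N p = N := by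
    simp only [diagIndicator, Fintype.sum_prod_type]
    simp
  simp only [Matrix.trace_diagonal, Pi.sub_apply, Pi.one_apply, Finset.sum_sub_distrib, h]
  simp [sq]

lemma trace_vecMulVec_diagIndicator (N : ℕ) :
    (Matrix.vecMulVec (diagIndicator N) (diagIndicator N)).trace = N := by
  rw [Matrix.trace_vecMulVec, diagIndicator_dotProduct_self]

lemma trace_Ghat_deltaE (N : ℕ) (hN : N ≠ 0) : (Ghat N deltaE).trace = 1 := by
  have hc : (N : ℂ) ≠ 0 := by exact_mod_cast hN
  rw [Ghat_deltaE_eq, Matrix.trace_smul, Matrix.trace_add,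
    trace_diagonal_one_sub_diagIndicator, trace_vecMulVec_diagIndicator, smul_eq_mul]
  field_simp
  ring

lemma trace_Ghat_deltaE_mul_self (N : ℕ) (hN : N ≠ 0) :
    (Ghat N deltaE * Ghat N deltaE).trace = (2 * N - 1) / (N : ℂ) ^ 3 := by
  have hc : (N : ℂ) ≠ 0 := by exact_mod_cast hN
  rw [Ghat_deltaE_mul_self, Matrix.trace_smul, Matrix.trace_add, Matrix.trace_smul,
    trace_diagonal_one_sub_diagIndicator, trace_vecMulVec_diagIndicator, smul_eq_mul, smul_eq_mul]
  field_simp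
  ring

lemma Matrix.IsHermitian.trace_mul_self_eq_sum_eigenvalues_sq {n : Type*} [Fintype n]
    [DecidableEq n] {A : Matrix n n ℂ} (hA : A.IsHermitian) :
    (A * A).trace = ∑ i, (hA.eigenvalues i : ℂ) ^ 2 := by
  conv_lhs => rw [hA.spectral_theorem, ← map_mul, Unitary.conjStarAlgAut_apply,
    Matrix.trace_mul_cycle, Unitary.coe_star_mul_self, one_mul]
  simp [Matrix.trace, sq]

lemma eigenvalues_Ghat_deltaE (N : ℕ) (hN : N ≠ 0) (i : Fin N × Fin N) :
    (Ghat_deltaE_isHermitian N).eigenvalues i = 0 ∨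
      (Ghat_deltaE_isHermitian N).eigenvalues i = ((N : ℝ) ^ 2)⁻¹ ∨
      (Ghat_deltaE_isHermitian N).eigenvalues i = (N : ℝ)⁻¹ := by
  set h := Ghat_deltaE_isHermitian N
  have hv := h.mulVec_eigenvectorBasis i
  have hv0 : (⇑(h.eigenvectorBasis i) : Fin N × Fin N → ℂ) ≠ 0 := by
    intro h0
    apply h.eigenvectorBasis.toBasis.ne_zero i
    ext p
    simpa using congrFun h0 p
  have hc := congrArg (fun M => M.mulVec (h.eigenvectorBasis i)) (Ghat_deltaE_cube N hN)
  obtain ⟨p, hp⟩ := Function.ne_iff.1 hv0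
  simp only [← Matrix.mulVec_mulVec, Matrix.sub_mulVec, Matrix.smul_mulVec, hv,
    Matrix.mulVec_smul] at hc
  have hcp := congrFun hc p
  simp only [Pi.smul_apply, Pi.sub_apply, Complex.real_smul, smul_eq_mul] at hcp
  set t := h.eigenvalues i
  have key : (t : ℂ) * (t - ((N : ℂ) ^ 2)⁻¹) * (t - (N : ℂ)⁻¹) = 0 := by
    apply mul_right_cancel₀ hp
    simp only [zero_mul]
    linear_combination hcp
  have key' : t * (t - ((N : ℝ) ^ 2)⁻¹) * (t - (N : ℝ)⁻¹) = 0 :=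
    Complex.ofReal_injective (by push_cast; exact key)
  simpa [sub_eq_zero, or_assoc] using key'

lemma vnEntropy_Ghat_deltaE (N : ℕ) (hN : 2 ≤ N) :
    vnEntropy (Ghat N deltaE) = 2 * Real.log N - Real.log N / N := by
  have hN0 : N ≠ 0 := by omega
  have hr : (N : ℝ) ≠ 0 := by exact_mod_cast hN0
  have hr1 : (N : ℝ) - 1 ≠ 0 := by
    have : (2 : ℝ) ≤ N := by exact_mod_cast hN
    linarith
  set h := Ghat_deltaE_isHermitian N
  rw [vnEntropy, dif_pos h]
  have h1 : ∑ i, h.eigenvalues i = 1 := by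
    have := h.trace_eq_sum_eigenvalues
    rw [trace_Ghat_deltaE N hN0] at this
    exact Complex.ofReal_injective (by push_cast; exact this.symm)
  have h2 : ∑ i, h.eigenvalues i ^ 2 = (2 * N - 1) / (N : ℝ) ^ 3 := by
    have := h.trace_mul_self_eq_sum_eigenvalues_sq
    rw [trace_Ghat_deltaE_mul_self N hN0] at this
    exact Complex.ofReal_injective (by push_cast; exact this.symm)
  set L := Real.log N with hL
  have h3 (i) : Real.negMulLog (h.eigenvalues i) =
      (2 * L + L / (N - 1)) * h.eigenvalues i -
        (L * N ^ 2 / (N - 1)) * h.eigenvalues i ^ 2 := by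
    rcases eigenvalues_Ghat_deltaE N hN0 i with hi | hi | hi <;> rw [hi]
    · simp
    · simp only [Real.negMulLog, Real.log_inv, Real.log_pow, ← hL]
      field_simp
      push_cast
      ring
    · simp only [Real.negMulLog, Real.log_inv, ← hL]
      field_simp
      ring
  simp only [h3, Finset.sum_sub_distrib, ← Finset.mul_sum, h1, h2]
  field_simp
  ring

/-- For `N ≥ 2`, the output of the complementary channel of `Φ_{N,l} ∘ Φ_{N,r}` at the
pure state `|e⟩⟨e|` has von Neumann entropy exactly `2 log N − (log N)/N`; consequently
the minimum output entropy of the composed channel is at most `2 log N − (log N)/N`. -/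
theorem entropy_Ghat_deltaE (N : ℕ) (hN : 2 ≤ N) :
    vnEntropy (Ghat N deltaE) = 2 * Real.log N - Real.log N / N ∧
    sInf {x : ℝ | ∃ ξ : l2FG, ‖ξ‖ = 1 ∧ x = vnEntropy (Ghat N ξ)}
      ≤ 2 * Real.log N - Real.log N / N := by
  have hE := vnEntropy_Ghat_deltaE N hN
  refine ⟨hE, ?_⟩
  by_cases hb : BddBelow {x : ℝ | ∃ ξ : l2FG, ‖ξ‖ = 1 ∧ x = vnEntropy (Ghat N ξ)}
  · refine csInf_le hb ⟨deltaE, ?_, hE.symm⟩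
    rw [deltaE, lp.norm_single (by norm_num), norm_one]
  · rw [Real.sInf_of_not_bddBelow hb]
    have hN1 : (1 : ℝ) ≤ N := by exact_mod_cast (by omega : 1 ≤ N)
    have hlog := Real.log_nonneg hN1
    linarith [div_le_self hlog hN1]
end
end
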